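/- arXiv:2602.10374 — 3 statements merged into one kernel-verified Lean document; each statement's English description precedes it below -/
import Mathlib

section
/- Let Q ∈ ℝ^{n×d} have orthonormal columns (QᵀQ = I_d), let f : ℝⁿ → ℝ, x⁰ ∈ ℝⁿ, Ŝ = [ŝ¹ ⋯ ŝ^p] ∈ ℝ^{d×p}, T̂_i ∈ ℝ^{d×q_i} for i = 1,…,p, and set S = Q Ŝ and T_i = Q T̂_i. Define f̂ : ℝᵈ → ℝ by f̂(x̂) = f(x⁰ + Q x̂). Then δ²_f(x⁰; S; T_{1:p}) = δ²_f̂(0; Ŝ; T̂_{1:p}) Qᵀ, where the i-th row of δ²_f(x⁰; S; T_{1:p}) is (∇ₛf(x⁰ + sⁱ; T_i) − ∇ₛf(x⁰; T_i))ᵀ and the i-th row of δ²_f̂(0; Ŝ; T̂_{1:p}) is (∇ₛf̂(ŝⁱ; T̂_i) − ∇ₛf̂(0; T̂_i))ᵀ. -/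
open Matrix

/-- Squared Frobenius norm of a real matrix. -/
noncomputable def frobSq {a b : ℕ} (A : Matrix (Fin a) (Fin b) ℝ) : ℝ :=
  ∑ i, ∑ j, (A i j) ^ 2

/-- Squared Euclidean norm of a real vector. -/
noncomputable def vecNormSq {a : ℕ} (v : Fin a → ℝ) : ℝ :=
  ∑ i, (v i) ^ 2

/-- `v` lies in the orthogonal complement of the column space of `Q`. -/
def inColPerp {n d : ℕ} (Q : Matrix (Fin n) (Fin d) ℝ) (v : Fin n → ℝ) : Prop :=
  ∀ u : Fin d → ℝ, Q.mulVec u ⬝ᵥ v = 0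

/-- Feasibility for the quadratic interpolation constraints: `p = (α, H)` with `H`
symmetric and `(dᵢ)ᵀ α + ½ (dᵢ)ᵀ H dᵢ = rhs i` for all `i`. -/
def QFeas {k m : ℕ} (dd : Fin m → Fin k → ℝ) (rhs : Fin m → ℝ)
    (p : (Fin k → ℝ) × Matrix (Fin k) (Fin k) ℝ) : Prop :=
  p.2.IsSymm ∧ ∀ i, dd i ⬝ᵥ p.1 + (1 / 2) * (dd i ⬝ᵥ p.2.mulVec (dd i)) = rhs i

/-- Objective of the minimum norm (MN) problem. -/
noncomputable def MNObj {k : ℕ} (p : (Fin k → ℝ) × Matrix (Fin k) (Fin k) ℝ) : ℝ :=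
  (1 / 2) * vecNormSq p.1 + (1 / 2) * frobSq p.2

/-- `p` is a minimizer of the MN problem. -/
def MNMin {k m : ℕ} (dd : Fin m → Fin k → ℝ) (rhs : Fin m → ℝ)
    (p : (Fin k → ℝ) × Matrix (Fin k) (Fin k) ℝ) : Prop :=
  QFeas dd rhs p ∧ ∀ q, QFeas dd rhs q → MNObj p ≤ MNObj q

/-- Objective of the minimum Frobenius norm (MFN) problem. -/
noncomputable def MFNObj {k : ℕ} (p : (Fin k → ℝ) × Matrix (Fin k) (Fin k) ℝ) : ℝ :=
  (1 / 2) * frobSq p.2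

/-- `p` is a minimizer of the MFN problem. -/
def MFNMin {k m : ℕ} (dd : Fin m → Fin k → ℝ) (rhs : Fin m → ℝ)
    (p : (Fin k → ℝ) × Matrix (Fin k) (Fin k) ℝ) : Prop :=
  QFeas dd rhs p ∧ ∀ q, QFeas dd rhs q → MFNObj p ≤ MFNObj q

/-- Objective of the least Frobenius norm updating (LFU) problem. -/
noncomputable def LFUObj {k : ℕ} (Hbar : Matrix (Fin k) (Fin k) ℝ)
    (p : (Fin k → ℝ) × Matrix (Fin k) (Fin k) ℝ) : ℝ :=
  (1 / 2) * frobSq (p.2 - Hbar)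

/-- `p` is a minimizer of the LFU problem with reference matrix `Hbar`. -/
def LFUMin {k m : ℕ} (dd : Fin m → Fin k → ℝ) (rhs : Fin m → ℝ)
    (Hbar : Matrix (Fin k) (Fin k) ℝ)
    (p : (Fin k → ℝ) × Matrix (Fin k) (Fin k) ℝ) : Prop :=
  QFeas dd rhs p ∧ ∀ q, QFeas dd rhs q → LFUObj Hbar p ≤ LFUObj Hbar q

/-- `X` is a Moore–Penrose pseudoinverse of `A`. -/
def IsMPInv {a b : ℕ} (A : Matrix (Fin a) (Fin b) ℝ) (X : Matrix (Fin b) (Fin a) ℝ) : Prop :=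
  A * X * A = A ∧ X * A * X = X ∧ (A * X)ᵀ = A * X ∧ (X * A)ᵀ = X * A

/-- The vector `δ_g(y⁰; W)` with `i`-th entry `g(y⁰ + wⁱ) − g(y⁰)`,
where `wⁱ` is the `i`-th column of `W`. -/
noncomputable def deltaVec {k p : ℕ} (g : (Fin k → ℝ) → ℝ) (y0 : Fin k → ℝ)
    (W : Matrix (Fin k) (Fin p) ℝ) : Fin p → ℝ :=
  fun i => g (y0 + fun j => W j i) - g y0

namespace IsMPInv

/-- The Moore–Penrose pseudoinverse is unique. -/
theorem unique {a b : ℕ} {A : Matrix (Fin a) (Fin b) ℝ} {X Y : Matrix (Fin b) (Fin a) ℝ}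
    (hX : IsMPInv A X) (hY : IsMPInv A Y) : X = Y := by
  obtain ⟨hX₁, hX₂, hX₃, hX₄⟩ := hX
  obtain ⟨hY₁, hY₂, hY₃, hY₄⟩ := hY
  have hl : A * X = A * Y :=
    calc A * X = (A * X)ᵀ := hX₃.symm
      _ = (A * Y * (A * X))ᵀ := by rw [← Matrix.mul_assoc, hY₁]
      _ = A * X * (A * Y) := by rw [transpose_mul, hX₃, hY₃]
      _ = A * Y := by rw [← Matrix.mul_assoc, hX₁]
  have hr : X * A = Y * A :=
    calc X * A = (X * A)ᵀ := hX₄.symm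
      _ = (X * A * (Y * A))ᵀ := by rw [Matrix.mul_assoc, ← Matrix.mul_assoc A, hY₁]
      _ = Y * A * (X * A) := by rw [transpose_mul, hX₄, hY₄]
      _ = Y * A := by rw [Matrix.mul_assoc, ← Matrix.mul_assoc A, hX₁]
  rw [← hX₂, hr, Matrix.mul_assoc, hl, ← Matrix.mul_assoc, hY₂]

/-- If `Q` has orthonormal columns, then `((Q T)ᵀ)† = Q (Tᵀ)†`. -/
theorem transpose_mul_of_orthonormal {n d m : ℕ} {Q : Matrix (Fin n) (Fin d) ℝ}
    (hQ : Qᵀ * Q = 1) {T : Matrix (Fin d) (Fin m) ℝ} {P : Matrix (Fin d) (Fin m) ℝ}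
    (hP : IsMPInv Tᵀ P) : IsMPInv (Q * T)ᵀ (Q * P) := by
  obtain ⟨h₁, h₂, h₃, h₄⟩ := hP
  have hl : (Q * T)ᵀ * (Q * P) = Tᵀ * P := by
    rw [transpose_mul, Matrix.mul_assoc, ← Matrix.mul_assoc Qᵀ, hQ, Matrix.one_mul]
  have hr : Q * P * (Q * T)ᵀ = Q * (P * Tᵀ) * Qᵀ := by
    simp only [transpose_mul, Matrix.mul_assoc]
  refine ⟨?_, ?_, ?_, ?_⟩
  · rw [hl, transpose_mul, ← Matrix.mul_assoc, h₁]
  · rw [Matrix.mul_assoc, hl, Matrix.mul_assoc, ← Matrix.mul_assoc P, h₂]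
  · rw [hl, h₃]
  · rw [hr, transpose_mul, transpose_mul, h₄, transpose_transpose, ← Matrix.mul_assoc]

end IsMPInv

/-- Function differences along `Q T` are those of the reduced function along `T`. -/
theorem deltaVec_mul {n d m : ℕ} (Q : Matrix (Fin n) (Fin d) ℝ) {f : (Fin n → ℝ) → ℝ}
    {x0 : Fin n → ℝ} {fh : (Fin d → ℝ) → ℝ} (hfh : ∀ xh, fh xh = f (x0 + Q.mulVec xh))
    (y : Fin d → ℝ) (T : Matrix (Fin d) (Fin m) ℝ) :
    deltaVec f (x0 + Q.mulVec y) (Q * T) = deltaVec fh y T := by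
  funext i
  simp only [deltaVec, hfh, mulVec_add, add_assoc]
  rfl

/-- With `S = Q Ŝ`, `Tᵢ = Q T̂ᵢ`, and `f̂(x̂) = f(x⁰ + Q x̂)`, the
matrices of generalized-simplex-gradient differences satisfy
`δ²_f(x⁰; S; T_{1:p}) = δ²_f̂(0; Ŝ; T̂_{1:p}) Qᵀ`.  Here `PT i` (resp. `PTh i`) is the
Moore–Penrose pseudoinverse of `(Q T̂ᵢ)ᵀ = Tᵢᵀ` (resp. of `T̂ᵢᵀ`), and the `i`-th row
of each matrix is the corresponding difference of generalized simplex gradients. -/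
theorem stmt_15 {n d p : ℕ} (q : Fin p → ℕ)
    (Q : Matrix (Fin n) (Fin d) ℝ) (hQ : Qᵀ * Q = 1)
    (f : (Fin n → ℝ) → ℝ) (x0 : Fin n → ℝ)
    (fh : (Fin d → ℝ) → ℝ) (hfh : ∀ xh, fh xh = f (x0 + Q.mulVec xh))
    (Sh : Matrix (Fin d) (Fin p) ℝ)
    (Th : (i : Fin p) → Matrix (Fin d) (Fin (q i)) ℝ)
    (PT : (i : Fin p) → Matrix (Fin n) (Fin (q i)) ℝ)
    (hPT : ∀ i, IsMPInv ((Q * Th i)ᵀ) (PT i))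
    (PTh : (i : Fin p) → Matrix (Fin d) (Fin (q i)) ℝ)
    (hPTh : ∀ i, IsMPInv (Th i)ᵀ (PTh i)) :
    (Matrix.of fun i =>
        (PT i).mulVec (deltaVec f (x0 + fun k => (Q * Sh) k i) (Q * Th i))
          - (PT i).mulVec (deltaVec f x0 (Q * Th i)))
      = (Matrix.of fun i =>
          (PTh i).mulVec (deltaVec fh (fun k => Sh k i) (Th i))
            - (PTh i).mulVec (deltaVec fh 0 (Th i))) * Qᵀ := by
  ext1 i
  have hS : deltaVec f (x0 + fun k => (Q * Sh) k i) (Q * Th i) =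
      deltaVec fh (fun k => Sh k i) (Th i) := deltaVec_mul Q hfh _ _
  have h0 : deltaVec f x0 (Q * Th i) = deltaVec fh 0 (Th i) := by
    simpa using deltaVec_mul Q hfh 0 (Th i)
  have hP : PT i = Q * PTh i :=
    (hPT i).unique (IsMPInv.transpose_mul_of_orthonormal hQ (hPTh i))
  intro j
  rw [mul_apply_eq_vecMul, vecMul_transpose]
  simp only [of_apply]
  rw [hS, h0, hP, ← mulVec_mulVec, ← mulVec_mulVec, ← mulVec_sub]
  rfl
end

section
/- Let Q ∈ ℝ^{n×d} have orthonormal columns (QᵀQ = I_d), let f : ℝⁿ → ℝ, x⁰ ∈ ℝⁿ, Ŝ = [ŝ¹ ⋯ ŝ^p] ∈ ℝ^{d×p}, T̂_i ∈ ℝ^{d×q_i} for i = 1,…,p, and set S = Q Ŝ and T_i = Q T̂_i. Define f̂ : ℝᵈ → ℝ by f̂(x̂) = f(x⁰ + Q x̂). Then the generalized simplex Hessians satisfy ∇²ₛf(x⁰; S; T_{1:p}) = Q ∇²ₛf̂(0; Ŝ; T̂_{1:p}) Qᵀ. -/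
open Matrix

theorem IsMPInv.unique_s16 {a b : ℕ} {A : Matrix (Fin a) (Fin b) ℝ}
    {X Y : Matrix (Fin b) (Fin a) ℝ} (hX : IsMPInv A X) (hY : IsMPInv A Y) : X = Y := by
  obtain ⟨hX1, hX2, hX3, hX4⟩ := hX
  obtain ⟨hY1, hY2, hY3, hY4⟩ := hY
  have hAX : A * X = A * Y := by
    calc A * X = (A * X)ᵀ := hX3.symm
      _ = ((A * Y) * (A * X))ᵀ := by rw [← Matrix.mul_assoc, hY1]
      _ = (A * X) * (A * Y) := by rw [transpose_mul, hX3, hY3]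
      _ = A * Y := by rw [← Matrix.mul_assoc, hX1]
  have hXA : X * A = Y * A := by
    calc X * A = (X * A)ᵀ := hX4.symm
      _ = ((X * A) * (Y * A))ᵀ := by rw [Matrix.mul_assoc, ← Matrix.mul_assoc A, hY1]
      _ = (Y * A) * (X * A) := by rw [transpose_mul, hX4, hY4]
      _ = Y * A := by rw [Matrix.mul_assoc, ← Matrix.mul_assoc A, hX1]
  calc X = X * A * X := hX2.symm
    _ = Y * A * Y := by rw [hXA, Matrix.mul_assoc, hAX, Matrix.mul_assoc]
    _ = Y := hY2

/-- Left multiplication by a matrix with orthonormal columns commutes with taking the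
Moore–Penrose pseudoinverse of the transpose. -/
theorem IsMPInv.orthonormal_mul {n d m : ℕ} {Q : Matrix (Fin n) (Fin d) ℝ} (hQ : Qᵀ * Q = 1)
    {W X : Matrix (Fin d) (Fin m) ℝ} (hX : IsMPInv Wᵀ X) : IsMPInv (Q * W)ᵀ (Q * X) := by
  obtain ⟨h1, h2, h3, h4⟩ := hX
  have hl : (Q * W)ᵀ * (Q * X) = Wᵀ * X := by
    rw [transpose_mul, Matrix.mul_assoc, ← Matrix.mul_assoc Qᵀ, hQ, Matrix.one_mul]
  have hr : (Q * X) * (Q * W)ᵀ = Q * (X * Wᵀ) * Qᵀ := by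
    simp only [transpose_mul, Matrix.mul_assoc]
  refine ⟨?_, ?_, ?_, ?_⟩
  · rw [hl, transpose_mul, ← Matrix.mul_assoc, h1]
  · rw [Matrix.mul_assoc, hl, Matrix.mul_assoc, ← Matrix.mul_assoc X, h2]
  · rw [hl, h3]
  · rw [hr, transpose_mul, transpose_mul, h4, transpose_transpose, ← Matrix.mul_assoc]

theorem deltaVec_comp_affine {n d m : ℕ} (Q : Matrix (Fin n) (Fin d) ℝ)
    {f : (Fin n → ℝ) → ℝ} {x0 : Fin n → ℝ} {fh : (Fin d → ℝ) → ℝ}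
    (hfh : ∀ xh, fh xh = f (x0 + Q.mulVec xh)) (y : Fin d → ℝ) (W : Matrix (Fin d) (Fin m) ℝ) :
    deltaVec f (x0 + Q.mulVec y) (Q * W) = deltaVec fh y W := by
  funext i
  simp only [deltaVec, hfh, mulVec_add, ← add_assoc]
  rfl

/-- With `S = Q Ŝ`, `Tᵢ = Q T̂ᵢ`, and `f̂(x̂) = f(x⁰ + Q x̂)`, the
generalized simplex Hessians satisfy
`∇²ₛf(x⁰; S; T_{1:p}) = Q ∇²ₛf̂(0; Ŝ; T̂_{1:p}) Qᵀ`.  Here `PS` (resp. `PSh`) is the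
Moore–Penrose pseudoinverse of `Sᵀ` (resp. `Ŝᵀ`), and `PT i` (resp. `PTh i`) is the
Moore–Penrose pseudoinverse of `Tᵢᵀ` (resp. `T̂ᵢᵀ`). -/
theorem stmt_16 {n d p : ℕ} (q : Fin p → ℕ)
    (Q : Matrix (Fin n) (Fin d) ℝ) (hQ : Qᵀ * Q = 1)
    (f : (Fin n → ℝ) → ℝ) (x0 : Fin n → ℝ)
    (fh : (Fin d → ℝ) → ℝ) (hfh : ∀ xh, fh xh = f (x0 + Q.mulVec xh))
    (Sh : Matrix (Fin d) (Fin p) ℝ)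
    (PS : Matrix (Fin n) (Fin p) ℝ) (hPS : IsMPInv ((Q * Sh)ᵀ) PS)
    (PSh : Matrix (Fin d) (Fin p) ℝ) (hPSh : IsMPInv Shᵀ PSh)
    (Th : (i : Fin p) → Matrix (Fin d) (Fin (q i)) ℝ)
    (PT : (i : Fin p) → Matrix (Fin n) (Fin (q i)) ℝ)
    (hPT : ∀ i, IsMPInv ((Q * Th i)ᵀ) (PT i))
    (PTh : (i : Fin p) → Matrix (Fin d) (Fin (q i)) ℝ)
    (hPTh : ∀ i, IsMPInv (Th i)ᵀ (PTh i)) :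
    PS * (Matrix.of fun i =>
        (PT i).mulVec (deltaVec f (x0 + fun k => (Q * Sh) k i) (Q * Th i))
          - (PT i).mulVec (deltaVec f x0 (Q * Th i)))
      = Q * (PSh * (Matrix.of fun i =>
          (PTh i).mulVec (deltaVec fh (fun k => Sh k i) (Th i))
            - (PTh i).mulVec (deltaVec fh 0 (Th i)))) * Qᵀ := by
  obtain rfl := hPS.unique_s16 (hPSh.orthonormal_mul hQ)
  have hPT' : ∀ i, PT i = Q * PTh i := fun i => (hPT i).unique_s16 ((hPTh i).orthonormal_mul hQ)
  have h0 : ∀ i, deltaVec f x0 (Q * Th i) = deltaVec fh 0 (Th i) := fun i => by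
    simpa using deltaVec_comp_affine Q hfh 0 (Th i)
  have hS : ∀ i, deltaVec f (x0 + fun k => (Q * Sh) k i) (Q * Th i)
      = deltaVec fh (fun k => Sh k i) (Th i) := fun i =>
    deltaVec_comp_affine Q hfh (fun k => Sh k i) (Th i)
  simp only [hPT', h0, hS, Matrix.mul_assoc, ← mulVec_mulVec, ← mulVec_sub]
  congr 2
  ext i j
  simp only [of_apply, mul_apply, mulVec, dotProduct, transpose_apply, mul_comm]
end

section
/- There exist α ∈ ℝⁿ and a symmetric H ∈ ℝ^{n×n} satisfying (dⁱ)ᵀα + ½(dⁱ)ᵀH dⁱ = f(x⁰ + dⁱ) − f(x⁰) for all i = 1,…,m if and only if there exist α̂ ∈ ℝᵈ and a symmetric Ĥ ∈ ℝ^{d×d} satisfying (d̂ⁱ)ᵀα̂ + ½(d̂ⁱ)ᵀĤ d̂ⁱ = f̂(d̂ⁱ) − f̂(0) for all i = 1,…,m; that is, a quadratic function interpolating f on Y exists if and only if a quadratic function interpolating f̂ on Ŷ exists. -/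
open Matrix

/-- A bilinear form evaluated on the range of `Q` is the congruent form `Qᵀ H Q`. -/
theorem mulVec_dotProduct_mulVec_mulVec {ι κ R : Type*} [Fintype ι] [Fintype κ] [CommSemiring R]
    (Q : Matrix ι κ R) (H : Matrix ι ι R) (u v : κ → R) :
    Q *ᵥ u ⬝ᵥ H *ᵥ (Q *ᵥ v) = u ⬝ᵥ (Qᵀ * H * Q) *ᵥ v := by
  rw [← vecMul_transpose, ← dotProduct_mulVec, mulVec_mulVec, mulVec_mulVec, Matrix.mul_assoc]

/-- Symmetry is preserved by the congruence `H ↦ Qᵀ H Q`. -/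
theorem Matrix.IsSymm.transpose_mul_mul {ι κ R : Type*} [Fintype ι] [CommSemiring R]
    {H : Matrix ι ι R} (hH : H.IsSymm) (Q : Matrix ι κ R) : (Qᵀ * H * Q).IsSymm := by
  simp [Matrix.IsSymm, transpose_mul, hH.eq, Matrix.mul_assoc]

/-- A quadratic function interpolating `f` on `Y` exists if and only
if a quadratic function interpolating `f̂` on `Ŷ` exists. -/
theorem stmt_18 {n d m : ℕ} (hn : 0 < n) (hd : 0 < d) (hm : 0 < m) (hdn : d < n)
    (Q : Matrix (Fin n) (Fin d) ℝ) (hQ : Qᵀ * Q = 1)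
    (f : (Fin n → ℝ) → ℝ) (x0 : Fin n → ℝ) (dh : Fin m → Fin d → ℝ)
    (fh : (Fin d → ℝ) → ℝ) (hfh : ∀ xh, fh xh = f (x0 + Q.mulVec xh)) :
    (∃ (α : Fin n → ℝ) (H : Matrix (Fin n) (Fin n) ℝ), H.IsSymm ∧
      ∀ i, Q.mulVec (dh i) ⬝ᵥ α
          + (1 / 2) * (Q.mulVec (dh i) ⬝ᵥ H.mulVec (Q.mulVec (dh i)))
        = f (x0 + Q.mulVec (dh i)) - f x0) ↔
    (∃ (αh : Fin d → ℝ) (Hh : Matrix (Fin d) (Fin d) ℝ), Hh.IsSymm ∧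
      ∀ i, dh i ⬝ᵥ αh + (1 / 2) * (dh i ⬝ᵥ Hh.mulVec (dh i))
        = fh (dh i) - fh 0) := by
  have h0 : fh 0 = f x0 := by simp [hfh]
  constructor
  · rintro ⟨α, H, hH, h⟩
    refine ⟨Qᵀ *ᵥ α, Qᵀ * H * Q, hH.transpose_mul_mul Q, fun i => ?_⟩
    rw [h0, hfh, ← h i, ← mulVec_dotProduct_mulVec_mulVec, dotProduct_mulVec, vecMul_transpose]
  · rintro ⟨α, H, hH, h⟩
    refine ⟨Q *ᵥ α, Q * H * Qᵀ, by simpa using hH.transpose_mul_mul Qᵀ, fun i => ?_⟩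
    have hQH : Qᵀ * (Q * H * Qᵀ) * Q = H := by
      rw [← Matrix.mul_assoc, ← Matrix.mul_assoc, hQ, Matrix.one_mul, Matrix.mul_assoc, hQ,
        Matrix.mul_one]
    rw [mulVec_dotProduct_mulVec_mulVec, hQH, ← hfh, ← h0, ← h i, ← vecMul_transpose,
      ← dotProduct_mulVec, mulVec_mulVec, hQ, one_mulVec]
end
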